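/- For every unit vector ψ̃ = a₀|0̃⟩ + a₁|1̃⟩ + a₂|2̃⟩ in the three-qutrit code subspace (with |a₀|² + |a₁|² + |a₂|² = 1), the reduced density matrix of ψ̃ on any single qutrit is maximally mixed: for each position p ∈ {1,2,3}, the 3×3 matrix with entries (ρ_p)_{mn} = Σ over the other two indices of ψ̃ evaluated with m (resp. n) in position p times the conjugate, equals (1/3)·I₃. -/

import Mathlib

open scoped ComplexConjugate Matrix

/-- Inner product `⟨v,w⟩ = Σ conj(v)·w`. -/
noncomputable def ip {ι : Type*} [Fintype ι] (v w : ι → ℂ) : ℂ :=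
  ∑ x, conj (v x) * w x

/-- The standard basis vector `|abc⟩` of the three-qutrit Hilbert space. -/
noncomputable def ket3 (a b c : Fin 3) : Fin 3 × Fin 3 × Fin 3 → ℂ :=
  fun p => if p = (a, b, c) then 1 else 0

/-- The three-qutrit code states `|0̃⟩, |1̃⟩, |2̃⟩`. -/
noncomputable def qcode : Fin 3 → (Fin 3 × Fin 3 × Fin 3 → ℂ) :=
  ![((Real.sqrt 3 : ℝ) : ℂ)⁻¹ • (ket3 0 0 0 + ket3 1 1 1 + ket3 2 2 2),
    ((Real.sqrt 3 : ℝ) : ℂ)⁻¹ • (ket3 0 1 2 + ket3 1 2 0 + ket3 2 0 1),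
    ((Real.sqrt 3 : ℝ) : ℂ)⁻¹ • (ket3 0 2 1 + ket3 1 0 2 + ket3 2 1 0)]

/-- For every unit vector `ψ = a₀|0̃⟩ + a₁|1̃⟩ + a₂|2̃⟩` of the three-qutrit code
subspace, the reduced density matrix of `ψ` on each single qutrit is maximally
mixed: `(ρ_p)_{mn} = (1/3)·δ_{mn}` for each position `p`. -/
theorem three_qutrit_reduced_density_maximally_mixed
    (a : Fin 3 → ℂ) (ψ : Fin 3 × Fin 3 × Fin 3 → ℂ)
    (hψ : ψ = ∑ i, a i • qcode i)
    (hnorm : ∑ i, ‖a i‖ ^ 2 = 1) :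
    (∀ m n, (∑ b, ∑ c, ψ (m, b, c) * conj (ψ (n, b, c))) =
        if m = n then 1 / 3 else 0) ∧
    (∀ m n, (∑ b, ∑ c, ψ (b, m, c) * conj (ψ (b, n, c))) =
        if m = n then 1 / 3 else 0) ∧
    (∀ m n, (∑ b, ∑ c, ψ (b, c, m) * conj (ψ (b, c, n))) =
        if m = n then 1 / 3 else 0) := by
  have hs : (((Real.sqrt 3 : ℝ) : ℂ)⁻¹) * (((Real.sqrt 3 : ℝ) : ℂ)⁻¹) = 1 / 3 := by
    rw [← mul_inv, ← Complex.ofReal_mul, Real.mul_self_sqrt (by norm_num)]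
    norm_num
  have hn : a 0 * conj (a 0) + a 1 * conj (a 1) + a 2 * conj (a 2) = 1 := by
    rw [Fin.sum_univ_three] at hnorm
    simp only [Complex.mul_conj, Complex.normSq_eq_norm_sq]
    exact_mod_cast hnorm
  have hp : ∀ x y z : Fin 3, ψ (x, y, z) =
      if x + y + z = 0 then ((Real.sqrt 3 : ℝ) : ℂ)⁻¹ * a (y - x) else 0 := by
    intro x y z
    subst hψ
    fin_cases x <;> fin_cases y <;> fin_cases z <;>
      simp [Fin.sum_univ_three, qcode, ket3, mul_comm] <;> rfl
  have hc : conj (((Real.sqrt 3 : ℝ) : ℂ)⁻¹) = ((Real.sqrt 3 : ℝ) : ℂ)⁻¹ := by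
    rw [map_inv₀, Complex.conj_ofReal]
  generalize ((Real.sqrt 3 : ℝ) : ℂ)⁻¹ = s at *
  have h1 : (-1 : Fin 3) = 2 := rfl
  have h2 : (-2 : Fin 3) = 1 := rfl
  refine ⟨?_, ?_, ?_⟩ <;> intro m n <;> simp only [hp, Fin.sum_univ_three] <;>
    fin_cases m <;> fin_cases n <;> simp [hc, h1, h2] <;>
    linear_combination (s * s) * hn + hs
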